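/- Let Ξ = (E,F,G) and Ξ̃ = (Ẽ,F̃,G̃) be DACSs with dimensions (l,n,m) on X and X̃ respectively, with rank E(x) = r constant on a neighborhood of x_p ∈ X and rank Ẽ(x̃) = r constant on a neighborhood of x̃_p ∈ X̃. If some ODE control system Σ ∈ Expl(Ξ) is locally sys-fb-equivalent at x_p and x̃_p to some Σ̃ ∈ Expl(Ξ̃), then Ξ and Ξ̃ are locally ex-fb-equivalent at x_p and x̃_p; moreover, writing Q(x)E(x) = [E₁(x); 0] for the data defining Σ and Q₁ for the GL(r,ℝ)-valued map with Ẽ₁(ψ(x)) = Q₁(x)E₁(x)(Dψ(x))⁻¹, the ex-fb-equivalence is realized by ψ, the feedback pair (α^u, β^u) of the sys-fb-equivalence, and the block matrix [[Q₁, Q₁E₁γ],[0, η]]. -/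

import Mathlib

open Matrix Set

/-- Stack an `r × n'` matrix on top of a `p × n'` matrix (`r + p = l`). -/
def stackM {r p l : ℕ} (hl : r + p = l) {n' : Type*} (A : Matrix (Fin r) n' ℝ)
    (B : Matrix (Fin p) n' ℝ) : Matrix (Fin l) n' ℝ :=
  (Matrix.fromRows A B).submatrix (fun i => finSumFinEquiv.symm (Fin.cast hl.symm i)) id

/-- Stack a vector of `ℝʳ` on top of a vector of `ℝᵖ` (`r + p = l`). -/
def stackV {r p l : ℕ} (hl : r + p = l) (a : Fin r → ℝ) (b : Fin p → ℝ) : Fin l → ℝ :=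
  fun i => Sum.elim a b (finSumFinEquiv.symm (Fin.cast hl.symm i))

/-- The `l × l` block matrix `[[Q₁, B],[0, η]]` (`r + p = l`). -/
def blockQ {r p l : ℕ} (hl : r + p = l) (Q₁ : Matrix (Fin r) (Fin r) ℝ)
    (B : Matrix (Fin r) (Fin p) ℝ) (η : Matrix (Fin p) (Fin p) ℝ) :
    Matrix (Fin l) (Fin l) ℝ :=
  (Matrix.fromBlocks Q₁ B 0 η).submatrix
    (fun i => finSumFinEquiv.symm (Fin.cast hl.symm i))
    (fun j => finSumFinEquiv.symm (Fin.cast hl.symm j))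

theorem blockQ_mul_stackM {r p l : ℕ} (hl : r + p = l) {n' : Type*}
    (Q₁ : Matrix (Fin r) (Fin r) ℝ) (B : Matrix (Fin r) (Fin p) ℝ)
    (η : Matrix (Fin p) (Fin p) ℝ) (M : Matrix (Fin r) n' ℝ) (N : Matrix (Fin p) n' ℝ) :
    blockQ hl Q₁ B η * stackM hl M N = stackM hl (Q₁ * M + B * N) (η * N) := by
  subst hl
  unfold blockQ stackM
  have key := Matrix.submatrix_mul_equiv (Matrix.fromBlocks Q₁ B 0 η) (Matrix.fromRows M N)
    (finSumFinEquiv (m := r) (n := p)).symm (finSumFinEquiv (m := r) (n := p)).symm id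
  rw [Matrix.fromBlocks_mul_fromRows, Matrix.zero_mul, zero_add] at key
  exact key

theorem blockQ_mulVec_stackV {r p l : ℕ} (hl : r + p = l)
    (Q₁ : Matrix (Fin r) (Fin r) ℝ) (B : Matrix (Fin r) (Fin p) ℝ)
    (η : Matrix (Fin p) (Fin p) ℝ) (a : Fin r → ℝ) (b : Fin p → ℝ) :
    (blockQ hl Q₁ B η).mulVec (stackV hl a b) =
      stackV hl (Q₁.mulVec a + B.mulVec b) (η.mulVec b) := by
  have key := congrArg (fun M : Matrix (Fin l) Unit ℝ => fun i => M i ())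
    (blockQ_mul_stackM hl Q₁ B η (Matrix.replicateCol Unit a) (Matrix.replicateCol Unit b))
  have hst : ∀ (M : Matrix (Fin r) Unit ℝ) (N : Matrix (Fin p) Unit ℝ) (i : Fin l),
      stackM hl M N i () = stackV hl (fun k => M k ()) (fun k => N k ()) i := by
    intro M N i
    simp only [stackM, stackV, Matrix.submatrix_apply, id]
    cases finSumFinEquiv.symm (Fin.cast hl.symm i) <;> rfl
  funext i
  have ki := congrFun key i
  simp only [hst, Matrix.mul_apply] at ki
  exact ki

theorem isUnit_blockQ {r p l : ℕ} (hl : r + p = l) {Q₁ : Matrix (Fin r) (Fin r) ℝ}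
    (B : Matrix (Fin r) (Fin p) ℝ) {η : Matrix (Fin p) (Fin p) ℝ}
    (hQ₁ : IsUnit Q₁) (hη : IsUnit η) : IsUnit (blockQ hl Q₁ B η) := by
  subst hl
  have key : IsUnit ((Matrix.fromBlocks Q₁ B 0 η).submatrix
      (finSumFinEquiv (m := r) (n := p)).symm (finSumFinEquiv (m := r) (n := p)).symm) := by
    rw [Matrix.isUnit_submatrix_equiv]
    exact Matrix.isUnit_fromBlocks_zero₂₁.mpr ⟨hQ₁, hη⟩
  exact key

theorem stackM_mul {r p l : ℕ} (hl : r + p = l) {n' k : Type*} [Fintype n']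
    (M : Matrix (Fin r) n' ℝ) (N : Matrix (Fin p) n' ℝ) (C : Matrix n' k ℝ) :
    stackM hl M N * C = stackM hl (M * C) (N * C) := by
  ext i j
  simp only [stackM, Matrix.mul_apply, Matrix.submatrix_apply, id]
  cases finSumFinEquiv.symm (Fin.cast hl.symm i) <;> simp [Matrix.mul_apply]

theorem stackM_mulVec {r p l : ℕ} (hl : r + p = l) {n' : Type*} [Fintype n']
    (M : Matrix (Fin r) n' ℝ) (N : Matrix (Fin p) n' ℝ) (v : n' → ℝ) :
    (stackM hl M N).mulVec v = stackV hl (M.mulVec v) (N.mulVec v) := by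
  funext i
  simp only [stackM, stackV, Matrix.mulVec, dotProduct, Matrix.submatrix_apply, id]
  cases finSumFinEquiv.symm (Fin.cast hl.symm i) <;> simp [Matrix.mulVec, dotProduct]

theorem stackV_add {r p l : ℕ} (hl : r + p = l) (a a' : Fin r → ℝ) (b b' : Fin p → ℝ) :
    stackV hl a b + stackV hl a' b' = stackV hl (a + a') (b + b') := by
  funext i
  simp only [stackV, Pi.add_apply]
  cases finSumFinEquiv.symm (Fin.cast hl.symm i) <;> rfl

/-- A matrix `g` spanning the kernel of `A` is annihilated by `A`. -/
theorem mul_eq_zero_of_range_eq_ker {r n s : ℕ} {A : Matrix (Fin r) (Fin n) ℝ}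
    {g : Matrix (Fin n) (Fin s) ℝ}
    (hg : LinearMap.range g.mulVecLin = LinearMap.ker A.mulVecLin) : A * g = 0 := by
  apply Matrix.ext_of_mulVec_single
  intro i
  have hmem : g.mulVec (Pi.single i 1) ∈ LinearMap.ker A.mulVecLin := hg ▸ ⟨_, rfl⟩
  rw [← Matrix.mulVec_mulVec, Matrix.zero_mulVec]
  exact hmem

/-- A matrix killing a spanning family `g` of `ker A` factors through `A`. -/
theorem mul_rightInverse_mul_eq {r n s k : ℕ} {A : Matrix (Fin r) (Fin n) ℝ}
    {Ad : Matrix (Fin n) (Fin r) ℝ} {g : Matrix (Fin n) (Fin s) ℝ}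
    {C : Matrix (Fin k) (Fin n) ℝ} (hA : A * Ad = 1)
    (hg : LinearMap.range g.mulVecLin = LinearMap.ker A.mulVecLin) (hC : C * g = 0) :
    C * Ad * A = C := by
  apply Matrix.ext_of_mulVec_single
  intro i
  set v : Fin n → ℝ := Pi.single i 1
  have hmem : v - (Ad * A).mulVec v ∈ LinearMap.range g.mulVecLin := by
    rw [hg, LinearMap.mem_ker, Matrix.mulVecLin_apply, Matrix.mulVec_sub, Matrix.mulVec_mulVec,
      ← Matrix.mul_assoc, hA, Matrix.one_mul, sub_self]
  obtain ⟨w, hw⟩ := hmem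
  have hz : C.mulVec (v - (Ad * A).mulVec v) = 0 := by
    rw [← hw, Matrix.mulVecLin_apply, Matrix.mulVec_mulVec, hC, Matrix.zero_mulVec]
  rw [Matrix.mulVec_sub, Matrix.mulVec_mulVec, ← Matrix.mul_assoc, sub_eq_zero] at hz
  exact hz.symm

/-- Suppose the DACSs `Ξ = (E,F,G)` on `X` and `Ξ̃ = (Ẽ,F̃,G̃)` on `X̃`
have constant rank `r` of `E`, `Ẽ`, with explicitation data `(Q,E₁,E₁†,F₁,G₁,g^v)` for
`Σ ∈ Expl(Ξ)` and `(Q̃,Ẽ₁,Ẽ₁†,F̃₁,G̃₁,g̃^v)` for `Σ̃ ∈ Expl(Ξ̃)`, and that `Σ` and `Σ̃`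
are locally sys-fb-equivalent at `x_p, x̃_p` via `(ψ, α^u, α^v, λ, γ, β^u, β^v, η)`.
Then `Ξ` and `Ξ̃` are locally ex-fb-equivalent at `x_p, x̃_p`; moreover, there is a
`GL(r,ℝ)`-valued `Q₁` with `Ẽ₁(ψ(x)) = Q₁(x)E₁(x)(Dψ(x))⁻¹` and the ex-fb-equivalence is
realized by `ψ`, the feedback pair `(α^u, β^u)`, and the block matrix
`[[Q₁, Q₁E₁γ],[0, η]]` (conjugated by the splitting maps `Q`, `Q̃`). -/
theorem stmt_2 {l n m r s p : ℕ} (hl : r + p = l) (hn : r + s = n)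
    (X Xt : Set (Fin n → ℝ)) (hXo : IsOpen X) (hXto : IsOpen Xt)
    (xp xtp : Fin n → ℝ) (hxp : xp ∈ X) (hxtp : xtp ∈ Xt)
    (E Et : (Fin n → ℝ) → Matrix (Fin l) (Fin n) ℝ)
    (F Ft : (Fin n → ℝ) → Fin l → ℝ)
    (G Gt : (Fin n → ℝ) → Matrix (Fin l) (Fin m) ℝ)
    (hE : ∀ i j, ContDiffOn ℝ (⊤ : ℕ∞) (fun x => E x i j) X)
    (hF : ContDiffOn ℝ (⊤ : ℕ∞) F X)
    (hG : ∀ i j, ContDiffOn ℝ (⊤ : ℕ∞) (fun x => G x i j) X)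
    (hEt : ∀ i j, ContDiffOn ℝ (⊤ : ℕ∞) (fun x => Et x i j) Xt)
    (hFt : ContDiffOn ℝ (⊤ : ℕ∞) Ft Xt)
    (hGt : ∀ i j, ContDiffOn ℝ (⊤ : ℕ∞) (fun x => Gt x i j) Xt)
    (hrE : ∀ x ∈ X, (E x).rank = r)
    (hrEt : ∀ x ∈ Xt, (Et x).rank = r)
    -- explicitation data for Σ ∈ Expl(Ξ)
    (Q : (Fin n → ℝ) → Matrix (Fin l) (Fin l) ℝ)
    (E₁ : (Fin n → ℝ) → Matrix (Fin r) (Fin n) ℝ)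
    (E₁d : (Fin n → ℝ) → Matrix (Fin n) (Fin r) ℝ)
    (F₁ : (Fin n → ℝ) → Fin r → ℝ)
    (G₁ : (Fin n → ℝ) → Matrix (Fin r) (Fin m) ℝ)
    (f : (Fin n → ℝ) → Fin n → ℝ)
    (gu : (Fin n → ℝ) → Matrix (Fin n) (Fin m) ℝ)
    (gv : (Fin n → ℝ) → Matrix (Fin n) (Fin s) ℝ)
    (h : (Fin n → ℝ) → Fin p → ℝ)
    (lu : (Fin n → ℝ) → Matrix (Fin p) (Fin m) ℝ)
    (hQ : ∀ i j, ContDiffOn ℝ (⊤ : ℕ∞) (fun x => Q x i j) X)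
    (hQu : ∀ x ∈ X, IsUnit (Q x))
    (hE₁d : ∀ i j, ContDiffOn ℝ (⊤ : ℕ∞) (fun x => E₁d x i j) X)
    (hgv : ∀ i j, ContDiffOn ℝ (⊤ : ℕ∞) (fun x => gv x i j) X)
    (hQE : ∀ x ∈ X, Q x * E x = stackM hl (E₁ x) 0)
    (hQF : ∀ x ∈ X, (Q x).mulVec (F x) = stackV hl (F₁ x) (h x))
    (hQG : ∀ x ∈ X, Q x * G x = stackM hl (G₁ x) (lu x))
    (hE₁surj : ∀ x ∈ X, Function.Surjective (E₁ x).mulVecLin)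
    (hE₁inv : ∀ x ∈ X, E₁ x * E₁d x = 1)
    (hgvker : ∀ x ∈ X, LinearMap.range (gv x).mulVecLin = LinearMap.ker (E₁ x).mulVecLin)
    (hf : ∀ x ∈ X, f x = (E₁d x).mulVec (F₁ x))
    (hgu : ∀ x ∈ X, gu x = E₁d x * G₁ x)
    -- explicitation data for Σ̃ ∈ Expl(Ξ̃)
    (Qt : (Fin n → ℝ) → Matrix (Fin l) (Fin l) ℝ)
    (E₁t : (Fin n → ℝ) → Matrix (Fin r) (Fin n) ℝ)
    (E₁dt : (Fin n → ℝ) → Matrix (Fin n) (Fin r) ℝ)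
    (F₁t : (Fin n → ℝ) → Fin r → ℝ)
    (G₁t : (Fin n → ℝ) → Matrix (Fin r) (Fin m) ℝ)
    (ft : (Fin n → ℝ) → Fin n → ℝ)
    (gut : (Fin n → ℝ) → Matrix (Fin n) (Fin m) ℝ)
    (gvt : (Fin n → ℝ) → Matrix (Fin n) (Fin s) ℝ)
    (ht : (Fin n → ℝ) → Fin p → ℝ)
    (lut : (Fin n → ℝ) → Matrix (Fin p) (Fin m) ℝ)
    (hQt : ∀ i j, ContDiffOn ℝ (⊤ : ℕ∞) (fun x => Qt x i j) Xt)
    (hQtu : ∀ x ∈ Xt, IsUnit (Qt x))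
    (hE₁dt : ∀ i j, ContDiffOn ℝ (⊤ : ℕ∞) (fun x => E₁dt x i j) Xt)
    (hgvt : ∀ i j, ContDiffOn ℝ (⊤ : ℕ∞) (fun x => gvt x i j) Xt)
    (hQEt : ∀ x ∈ Xt, Qt x * Et x = stackM hl (E₁t x) 0)
    (hQFt : ∀ x ∈ Xt, (Qt x).mulVec (Ft x) = stackV hl (F₁t x) (ht x))
    (hQGt : ∀ x ∈ Xt, Qt x * Gt x = stackM hl (G₁t x) (lut x))
    (hE₁tsurj : ∀ x ∈ Xt, Function.Surjective (E₁t x).mulVecLin)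
    (hE₁tinv : ∀ x ∈ Xt, E₁t x * E₁dt x = 1)
    (hgvtker : ∀ x ∈ Xt,
      LinearMap.range (gvt x).mulVecLin = LinearMap.ker (E₁t x).mulVecLin)
    (hft : ∀ x ∈ Xt, ft x = (E₁dt x).mulVec (F₁t x))
    (hgut : ∀ x ∈ Xt, gut x = E₁dt x * G₁t x)
    -- local sys-fb-equivalence data between Σ and Σ̃
    (U Ut : Set (Fin n → ℝ)) (ψ ψinv : (Fin n → ℝ) → (Fin n → ℝ))
    (Dψ : (Fin n → ℝ) → Matrix (Fin n) (Fin n) ℝ)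
    (αu : (Fin n → ℝ) → Fin m → ℝ)
    (αv : (Fin n → ℝ) → Fin s → ℝ)
    (lam : (Fin n → ℝ) → Matrix (Fin s) (Fin m) ℝ)
    (γ : (Fin n → ℝ) → Matrix (Fin n) (Fin p) ℝ)
    (βu : (Fin n → ℝ) → Matrix (Fin m) (Fin m) ℝ)
    (βv : (Fin n → ℝ) → Matrix (Fin s) (Fin s) ℝ)
    (η : (Fin n → ℝ) → Matrix (Fin p) (Fin p) ℝ)
    (hUo : IsOpen U) (hUto : IsOpen Ut) (hxpU : xp ∈ U) (hxtpU : xtp ∈ Ut)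
    (hUX : U ⊆ X) (hUtXt : Ut ⊆ Xt)
    (hψxp : ψ xp = xtp) (hψmaps : MapsTo ψ U Ut) (hψinvmaps : MapsTo ψinv Ut U)
    (hli : ∀ x ∈ U, ψinv (ψ x) = x) (hri : ∀ y ∈ Ut, ψ (ψinv y) = y)
    (hψ : ContDiffOn ℝ (⊤ : ℕ∞) ψ U) (hψinv : ContDiffOn ℝ (⊤ : ℕ∞) ψinv Ut)
    (hDψ : ∀ x ∈ U, HasFDerivAt ψ
      (LinearMap.toContinuousLinearMap (Matrix.mulVecLin (Dψ x))) x)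
    (hDψu : ∀ x ∈ U, IsUnit (Dψ x))
    (hαu : ContDiffOn ℝ (⊤ : ℕ∞) αu U) (hαv : ContDiffOn ℝ (⊤ : ℕ∞) αv U)
    (hlam : ∀ i j, ContDiffOn ℝ (⊤ : ℕ∞) (fun x => lam x i j) U)
    (hγ : ∀ i j, ContDiffOn ℝ (⊤ : ℕ∞) (fun x => γ x i j) U)
    (hβu : ∀ i j, ContDiffOn ℝ (⊤ : ℕ∞) (fun x => βu x i j) U)
    (hβv : ∀ i j, ContDiffOn ℝ (⊤ : ℕ∞) (fun x => βv x i j) U)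
    (hη : ∀ i j, ContDiffOn ℝ (⊤ : ℕ∞) (fun x => η x i j) U)
    (hβuu : ∀ x ∈ U, IsUnit (βu x)) (hβvu : ∀ x ∈ U, IsUnit (βv x))
    (hηu : ∀ x ∈ U, IsUnit (η x))
    (heqf : ∀ x ∈ U, ft (ψ x) = (Dψ x).mulVec
      (f x + (gu x).mulVec (αu x) + (gv x).mulVec (αv x + (lam x).mulVec (αu x))
        + (γ x).mulVec (h x + (lu x).mulVec (αu x))))
    (heqgu : ∀ x ∈ U, gut (ψ x) =
      Dψ x * (gu x * βu x + gv x * (lam x * βu x) + γ x * (lu x * βu x)))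
    (heqgv : ∀ x ∈ U, gvt (ψ x) = Dψ x * (gv x * βv x))
    (heqh : ∀ x ∈ U, ht (ψ x) = (η x).mulVec (h x + (lu x).mulVec (αu x)))
    (heqlu : ∀ x ∈ U, lut (ψ x) = η x * (lu x * βu x)) :
    ∃ Q₁ : (Fin n → ℝ) → Matrix (Fin r) (Fin r) ℝ,
      (∀ x ∈ U, IsUnit (Q₁ x)) ∧
      (∀ x ∈ U, E₁t (ψ x) = Q₁ x * E₁ x * (Dψ x)⁻¹) ∧
      (∀ x ∈ U,
        IsUnit ((Qt (ψ x))⁻¹ * blockQ hl (Q₁ x) (Q₁ x * E₁ x * γ x) (η x) * Q x)) ∧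
      (∀ x ∈ U, Et (ψ x) =
        (Qt (ψ x))⁻¹ * blockQ hl (Q₁ x) (Q₁ x * E₁ x * γ x) (η x) * Q x
          * E x * (Dψ x)⁻¹) ∧
      (∀ x ∈ U, Ft (ψ x) =
        ((Qt (ψ x))⁻¹ * blockQ hl (Q₁ x) (Q₁ x * E₁ x * γ x) (η x) * Q x).mulVec
          (F x + (G x).mulVec (αu x))) ∧
      (∀ x ∈ U, Gt (ψ x) =
        (Qt (ψ x))⁻¹ * blockQ hl (Q₁ x) (Q₁ x * E₁ x * γ x) (η x) * Q x
          * G x * βu x) := by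
  have hAtD : ∀ x ∈ U, E₁t (ψ x) * Dψ x * E₁d x * E₁ x = E₁t (ψ x) * Dψ x := by
    intro x hx
    refine mul_rightInverse_mul_eq (hE₁inv x (hUX hx)) (hgvker x (hUX hx)) ?_
    have hz := mul_eq_zero_of_range_eq_ker (hgvtker _ (hUtXt (hψmaps hx)))
    rw [heqgv x hx, ← Matrix.mul_assoc, ← Matrix.mul_assoc] at hz
    rw [← Matrix.mul_nonsing_inv_cancel_right (βv x) (E₁t (ψ x) * Dψ x * gv x)
      ((Matrix.isUnit_iff_isUnit_det _).mp (hβvu x hx)), hz, Matrix.zero_mul]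
  have hAgv : ∀ x ∈ U, E₁ x * gv x = 0 := fun x hx =>
    mul_eq_zero_of_range_eq_ker (hgvker x (hUX hx))
  have hDdet : ∀ x ∈ U, IsUnit (Dψ x).det := fun x hx =>
    (Matrix.isUnit_iff_isUnit_det _).mp (hDψu x hx)
  have hQtdet : ∀ x ∈ U, IsUnit (Qt (ψ x)).det := fun x hx =>
    (Matrix.isUnit_iff_isUnit_det _).mp (hQtu _ (hUtXt (hψmaps hx)))
  obtain ⟨Q₁, hQ₁⟩ : ∃ Q₁ : (Fin n → ℝ) → Matrix (Fin r) (Fin r) ℝ,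
      ∀ x, Q₁ x = E₁t (ψ x) * Dψ x * E₁d x := ⟨_, fun _ => rfl⟩
  have hQ₁E : ∀ x ∈ U, Q₁ x * E₁ x = E₁t (ψ x) * Dψ x := fun x hx => by
    rw [hQ₁, hAtD x hx]
  have hE₁t : ∀ x ∈ U, E₁t (ψ x) = Q₁ x * E₁ x * (Dψ x)⁻¹ := fun x hx => by
    rw [hQ₁E x hx, Matrix.mul_nonsing_inv_cancel_right _ _ (hDdet x hx)]
  have hQ₁u : ∀ x ∈ U, IsUnit (Q₁ x) := by
    intro x hx
    refine IsUnit.of_mul_eq_one (E₁ x * (Dψ x)⁻¹ * E₁dt (ψ x)) ?_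
    rw [← Matrix.mul_assoc, ← Matrix.mul_assoc, ← hE₁t x hx,
      hE₁tinv _ (hUtXt (hψmaps hx))]
  refine ⟨Q₁, hQ₁u, hE₁t, ?_, ?_, ?_, ?_⟩
  · intro x hx
    exact (((Matrix.isUnit_nonsing_inv_iff).mpr (hQtu _ (hUtXt (hψmaps hx)))).mul
      (isUnit_blockQ hl _ (hQ₁u x hx) (hηu x hx))).mul (hQu x (hUX hx))
  · intro x hx
    have hst : Qt (ψ x) * Et (ψ x) =
        blockQ hl (Q₁ x) (Q₁ x * E₁ x * γ x) (η x) * (Q x * E x) * (Dψ x)⁻¹ := by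
      rw [hQEt _ (hUtXt (hψmaps hx)), hQE x (hUX hx), blockQ_mul_stackM, stackM_mul,
        hE₁t x hx]
      simp only [Matrix.mul_zero, Matrix.zero_mul, add_zero]
    rw [← Matrix.nonsing_inv_mul_cancel_left (Qt (ψ x)) (Et (ψ x)) (hQtdet x hx), hst]
    simp only [Matrix.mul_assoc]
  · intro x hx
    have hF₁t : F₁t (ψ x) = (Q₁ x).mulVec (F₁ x + (G₁ x).mulVec (αu x)) +
        (Q₁ x * E₁ x * γ x).mulVec (h x + (lu x).mulVec (αu x)) := by
      have hfe := congrArg (E₁t (ψ x)).mulVec (heqf x hx)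
      rw [hft _ (hUtXt (hψmaps hx)), Matrix.mulVec_mulVec, hE₁tinv _ (hUtXt (hψmaps hx)),
        Matrix.one_mulVec, Matrix.mulVec_mulVec, ← hQ₁E x hx, hf x (hUX hx),
        hgu x (hUX hx)] at hfe
      rw [hfe]
      have hcancel : Q₁ x * E₁ x * E₁d x = Q₁ x := by
        rw [Matrix.mul_assoc, hE₁inv x (hUX hx), Matrix.mul_one]
      have hgz : Q₁ x * E₁ x * gv x = 0 := by
        rw [Matrix.mul_assoc, hAgv x hx, Matrix.mul_zero]
      rw [Matrix.mulVec_add, Matrix.mulVec_add, Matrix.mulVec_add, Matrix.mulVec_mulVec,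
        Matrix.mulVec_mulVec, Matrix.mulVec_mulVec, Matrix.mulVec_mulVec, hgz,
        ← Matrix.mul_assoc, hcancel, Matrix.zero_mulVec, add_zero, Matrix.mulVec_add (Q₁ x),
        Matrix.mulVec_mulVec]
    have hst : (Qt (ψ x)).mulVec (Ft (ψ x)) =
        (blockQ hl (Q₁ x) (Q₁ x * E₁ x * γ x) (η x)).mulVec
          ((Q x).mulVec (F x + (G x).mulVec (αu x))) := by
      rw [hQFt _ (hUtXt (hψmaps hx)), Matrix.mulVec_add, hQF x (hUX hx), Matrix.mulVec_mulVec,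
        hQG x (hUX hx), stackM_mulVec, stackV_add, blockQ_mulVec_stackV, hF₁t, heqh x hx]
    rw [← Matrix.mulVec_mulVec, ← Matrix.mulVec_mulVec, ← hst, Matrix.mulVec_mulVec,
      Matrix.nonsing_inv_mul _ (hQtdet x hx), Matrix.one_mulVec]
  · intro x hx
    have hG₁t : G₁t (ψ x) = Q₁ x * (G₁ x * βu x) +
        Q₁ x * E₁ x * γ x * (lu x * βu x) := by
      have hge := congrArg (E₁t (ψ x) * ·) (heqgu x hx)
      rw [hgut _ (hUtXt (hψmaps hx)), ← Matrix.mul_assoc, hE₁tinv _ (hUtXt (hψmaps hx)),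
        Matrix.one_mul, ← Matrix.mul_assoc, ← hQ₁E x hx, hgu x (hUX hx)] at hge
      rw [hge]
      have hcancel : Q₁ x * E₁ x * (E₁d x * G₁ x * βu x) = Q₁ x * (G₁ x * βu x) := by
        rw [Matrix.mul_assoc (Q₁ x), Matrix.mul_assoc (E₁d x), ← Matrix.mul_assoc (E₁ x),
          hE₁inv x (hUX hx), Matrix.one_mul]
      have hgz : Q₁ x * E₁ x * (gv x * (lam x * βu x)) = 0 := by
        rw [Matrix.mul_assoc (Q₁ x), ← Matrix.mul_assoc (E₁ x), hAgv x hx, Matrix.zero_mul,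
          Matrix.mul_zero]
      rw [Matrix.mul_add, Matrix.mul_add, hcancel, hgz, add_zero, ← Matrix.mul_assoc _ (γ x)]
    have hst : Qt (ψ x) * Gt (ψ x) =
        blockQ hl (Q₁ x) (Q₁ x * E₁ x * γ x) (η x) * (Q x * G x * βu x) := by
      rw [hQGt _ (hUtXt (hψmaps hx)), hQG x (hUX hx), stackM_mul, blockQ_mul_stackM, hG₁t,
        heqlu x hx]
    rw [← Matrix.nonsing_inv_mul_cancel_left (Qt (ψ x)) (Gt (ψ x)) (hQtdet x hx), hst]
    simp only [Matrix.mul_assoc]
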